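/- arXiv:2602.21344 — 2 statements merged into one kernel-verified Lean document; each statement's English description precedes it below -/
import Mathlib

section
/- Let d ≥ 2 and ℓ ≥ 0, and let f : ℝ^d_x × ℝ^d_v → ℝ be twice continuously differentiable in x. Then ‖⟨x⟩^ℓ ∇_x f‖_{L^∞_{x,v}} ≲_{d,ℓ} ‖⟨x⟩^{2ℓ} f‖_{L^∞_{x,v}} + ‖∇_x² f‖_{L^∞_{x,v}}. -/
open MeasureTheory Real Set Filter Function
open scoped ENNReal RealInnerProductSpace Topology

noncomputable section

/-- `d`-dimensional Euclidean space. -/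
abbrev Ed (d : ℕ) : Type := EuclideanSpace ℝ (Fin d)

/-- The plane `ℝ²`. -/
abbrev E2 : Type := Ed 2

/-- Japanese bracket `⟨r⟩ = (1+r²)^{1/2}` of a real number. -/
def jb (r : ℝ) : ℝ := Real.sqrt (1 + r ^ 2)

/-- `⟨(w,z)⟩ = (1+|w|²+|z|²)^{1/2}`. -/
def jbp (wz : E2 × E2) : ℝ := Real.sqrt (1 + ‖wz.1‖ ^ 2 + ‖wz.2‖ ^ 2)

/-- `f(s) = 1/(1-s²)`. -/
def fS (s : ℝ) : ℝ := (1 - s ^ 2)⁻¹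

/-- `F(s) = arctanh s = ½ ln((1+s)/(1-s))`. -/
def FS (s : ℝ) : ℝ := Real.log ((1 + s) / (1 - s)) / 2

/-- The 2D electric field generated by a (time-slice) particle density `g(q,p)`:
`E[g](x) = (2π)⁻¹ ∬ (x-y)/|x-y|² g(y,v)² dy dv`. -/
def field (g : E2 × E2 → ℝ) (x : E2) : E2 :=
  (2 * π)⁻¹ • ∫ yv : E2 × E2, ((g yv) ^ 2 * (‖x - yv.1‖ ^ 2)⁻¹) • (x - yv.1)

/-- The `d`-dimensional electric field with kernel `∇Γ(x) = c x/|x|^d`. -/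
def fieldD (d : ℕ) (c : ℝ) (g : Ed d × Ed d → ℝ) (x : Ed d) : Ed d :=
  ∫ yv : Ed d × Ed d, ((g yv) ^ 2 * c * (‖x - yv.1‖ ^ d)⁻¹) • (x - yv.1)

/-- The Newtonian (logarithmic) potential in 2D: `φ[g](x) = (2π)⁻¹ ∬ ln|x-y| g² dy dv`,
so that `∇φ[g] = field g`. -/
def pot (g : E2 × E2 → ℝ) (x : E2) : ℝ :=
  (2 * π)⁻¹ * ∫ yv : E2 × E2, Real.log ‖x - yv.1‖ * (g yv) ^ 2

/-- `μ` is a (global, strong) solution of the 2D Vlasov--Poisson system with a repulsive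
harmonic potential: `∂_t μ + v·∇_x μ + x·∇_v μ + λ E[μ]·∇_v μ = 0`. -/
def IsVPSol (lam : ℝ) (μ : ℝ → E2 × E2 → ℝ) : Prop :=
  (∀ xv : E2 × E2, Differentiable ℝ fun t => μ t xv) ∧
  (∀ t : ℝ, Differentiable ℝ (μ t)) ∧
  ∀ (t : ℝ) (x v : E2),
    deriv (fun t' => μ t' (x, v)) t
      + fderiv ℝ (fun x' => μ t (x', v)) x v
      + fderiv ℝ (fun v' => μ t (x, v')) v x
      + fderiv ℝ (fun v' => μ t (x, v')) v (lam • field (μ t) x) = 0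

/-- `γ` is a strong solution of the lens-transformed 2D Vlasov--Poisson system
`∂_s γ + p·∇_q γ + λ f(s) E[γ]·∇_p γ = 0` on the time set `I`. -/
def IsLensSolOn (lam : ℝ) (γ : ℝ → E2 × E2 → ℝ) (I : Set ℝ) : Prop :=
  (∀ xv : E2 × E2, DifferentiableOn ℝ (fun s => γ s xv) I) ∧
  (∀ s ∈ I, Differentiable ℝ (γ s)) ∧
  ∀ s ∈ I, ∀ q p : E2,
    derivWithin (fun s' => γ s' (q, p)) I s
      + fderiv ℝ (fun q' => γ s (q', p)) q p
      + fderiv ℝ (fun p' => γ s (q, p')) p ((lam * fS s) • field (γ s) q) = 0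

/-- Asymptotic trajectory `𝒳(t,x,v)` (future). -/
def scatX (lam : ℝ) (Einf : E2 → E2) (t : ℝ) (x v : E2) : E2 :=
  Real.cosh t • x + Real.sinh t • v - (lam * t * Real.exp (-t)) • Einf (x + v)

/-- Asymptotic trajectory `𝒱(t,x,v)` (future). -/
def scatV (lam : ℝ) (Einf : E2 → E2) (t : ℝ) (x v : E2) : E2 :=
  Real.cosh t • v + Real.sinh t • x + (lam * t * Real.exp (-t)) • Einf (x + v)

/-- Asymptotic trajectory `𝒳₋(t,x,v)` (past). -/
def scatXm (lam : ℝ) (Em : E2 → E2) (t : ℝ) (x v : E2) : E2 :=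
  Real.cosh t • x + Real.sinh t • v + (lam * t * Real.exp t) • Em (x - v)

/-- Asymptotic trajectory `𝒱₋(t,x,v)` (past). -/
def scatVm (lam : ℝ) (Em : E2 → E2) (t : ℝ) (x v : E2) : E2 :=
  Real.cosh t • v + Real.sinh t • x + (lam * t * Real.exp t) • Em (x - v)

/-- The `W^{k,∞}` norm of a map. -/
def WkInf (k : ℕ) {α F : Type*} [NormedAddCommGroup α] [NormedSpace ℝ α] [MeasureSpace α]
    [NormedAddCommGroup F] [NormedSpace ℝ F] (Ef : α → F) : ℝ≥0∞ :=
  ∑ m ∈ Finset.range (k + 1), eLpNorm (fun x => ‖iteratedFDeriv ℝ m Ef x‖) ⊤ volume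

/-- Poisson bracket `{g,h} = ∇_q g·∇_p h − ∇_p g·∇_q h` on `ℝ^d_q × ℝ^d_p`. -/
def pbr {d : ℕ} (g h : Ed d × Ed d → ℝ) (a : Ed d × Ed d) : ℝ :=
  fderiv ℝ (fun q => g (q, a.2)) a.1 (gradient (fun p => h (a.1, p)) a.2)
    - fderiv ℝ (fun p => g (a.1, p)) a.2 (gradient (fun q => h (q, a.2)) a.1)

/-- Divergence of a vector field on `ℝ²`. -/
def divg (V : E2 → E2) (q : E2) : ℝ :=
  ∑ i : Fin 2, fderiv ℝ (fun x => V x i) q (EuclideanSpace.single i 1)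

/-- Spatial density `ρ(s,q) = ∫ γ² dp`. -/
def dens (γ : ℝ → E2 × E2 → ℝ) (s : ℝ) (q : E2) : ℝ := ∫ p : E2, (γ s (q, p)) ^ 2

/-- Current `j(s,q) = ∫ p γ² dp`. -/
def jcur (γ : ℝ → E2 × E2 → ℝ) (s : ℝ) (q : E2) : E2 := ∫ p : E2, (γ s (q, p)) ^ 2 • p

/-- The change of variables `q = w + (s+1)z + λF(s)(s+1)E₋₁(w)`. -/
def qOf (lam : ℝ) (Em : E2 → E2) (s : ℝ) (w z : E2) : E2 :=
  w + (s + 1) • z + (lam * FS s * (s + 1)) • Em w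

/-- The inverse change of variables `w = q - (s+1)p`. -/
def wOf (s : ℝ) (q p : E2) : E2 := q - (s + 1) • p

/-- The inverse change of variables `z = p - λF(s)E₋₁(q-(s+1)p)`. -/
def zOf (lam : ℝ) (Em : E2 → E2) (s : ℝ) (q p : E2) : E2 :=
  p - (lam * FS s) • Em (q - (s + 1) • p)

/-- `γ` expressed from `σ` through the change of variables. -/
def gamOf (lam : ℝ) (Em : E2 → E2) (σ : ℝ → E2 × E2 → ℝ) (s : ℝ) (qp : E2 × E2) : ℝ :=
  σ s (wOf s qp.1 qp.2, zOf lam Em s qp.1 qp.2)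

/-- The new Hamiltonian `𝒦 = -λ f(s) [φ(s,q(s,w,z)) - φ₋₁(w)]`. -/
def Kham (lam : ℝ) (σm : E2 × E2 → ℝ) (σ : ℝ → E2 × E2 → ℝ) (s : ℝ) (wz : E2 × E2) : ℝ :=
  -(lam * fS s) *
    (pot (gamOf lam (field σm) σ s) (qOf lam (field σm) s wz.1 wz.2) - pot σm wz.1)

/-- The weight `θ(s,z) = ⟨z⟩/(1+(s+1)⟨z⟩)`. -/
def thw (s : ℝ) (z : E2) : ℝ := jb ‖z‖ / (1 + (s + 1) * jb ‖z‖)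

/-- `∇_z k`. -/
def dKz (k : E2 × E2 → ℝ) (w z : E2) : E2 := gradient (fun z' => k (w, z')) z

/-- `∇_w k`. -/
def dKw (k : E2 × E2 → ℝ) (w z : E2) : E2 := gradient (fun w' => k (w', z)) w

/-- `∇_w ∇_z k`. -/
def dKwz (k : E2 × E2 → ℝ) (w z : E2) : E2 →L[ℝ] E2 :=
  fderiv ℝ (fun w' => dKz k w' z) w

/-- `∇_z ∇_z k`. -/
def dKzz (k : E2 × E2 → ℝ) (w z : E2) : E2 →L[ℝ] E2 :=
  fderiv ℝ (fun z' => dKz k w z') z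

/-- `∇_w ∇_w k`. -/
def dKww (k : E2 × E2 → ℝ) (w z : E2) : E2 →L[ℝ] E2 :=
  fderiv ℝ (fun w' => dKw k w' z) w

/-- `∇³_{www} k`. -/
def dKwww (k : E2 × E2 → ℝ) (w z : E2) : E2 →L[ℝ] E2 →L[ℝ] E2 :=
  fderiv ℝ (fun w' => dKww k w' z) w

/-- `∇³_{wwz} k`. -/
def dKwwz (k : E2 × E2 → ℝ) (w z : E2) : E2 →L[ℝ] E2 →L[ℝ] E2 :=
  fderiv ℝ (fun w' => dKwz k w' z) w

/-- `∇³_{wzz} k`. -/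
def dKwzz (k : E2 × E2 → ℝ) (w z : E2) : E2 →L[ℝ] E2 →L[ℝ] E2 :=
  fderiv ℝ (fun w' => dKzz k w' z) w

/-- `∇³_{zzz} k`. -/
def dKzzz (k : E2 × E2 → ℝ) (w z : E2) : E2 →L[ℝ] E2 →L[ℝ] E2 :=
  fderiv ℝ (fun z' => dKzz k w z') z

/-- First-order Taylor estimate with a globally bounded second derivative. -/
lemma norm_sub_sub_fderiv_le_of_norm_iteratedFDeriv_two_le {E : Type*}
    [NormedAddCommGroup E] [NormedSpace ℝ E] {g : E → ℝ} (hg : ContDiff ℝ 2 g) {B : ℝ}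
    (hB : ∀ y, ‖iteratedFDeriv ℝ 2 g y‖ ≤ B) (x w : E) :
    ‖g (x + w) - g x - fderiv ℝ g x w‖ ≤ B * ‖w‖ * ‖w‖ := by
  have hB0 : 0 ≤ B := (norm_nonneg _).trans (hB x)
  have hdiff : Differentiable ℝ g := hg.differentiable (by norm_num)
  have hdiff' : Differentiable ℝ (fderiv ℝ g) :=
    (hg.fderiv_right (m := 1) (by norm_num)).differentiable (by norm_num)
  have hsecond : ∀ y, ‖fderiv ℝ (fderiv ℝ g) y‖ ≤ B := fun y => by
    have h := hB y
    rwa [← norm_iteratedFDeriv_fderiv (n := 1), ← norm_iteratedFDeriv_fderiv (n := 0),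
      norm_iteratedFDeriv_zero] at h
  have hlip : ∀ y, ‖fderiv ℝ g y - fderiv ℝ g x‖ ≤ B * ‖y - x‖ := fun y =>
    convex_univ.norm_image_sub_le_of_norm_fderiv_le (fun z _ => hdiff' z)
      (fun z _ => hsecond z) (mem_univ x) (mem_univ y)
  have h := (convex_segment x (x + w)).norm_image_sub_le_of_norm_fderiv_le'
    (f := g) (φ := fderiv ℝ g x) (C := B * ‖w‖) (fun z _ => hdiff z)
    (fun z hz => (hlip z).trans <| by
      gcongr
      simpa using norm_sub_le_of_mem_segment hz)
    (left_mem_segment ℝ x (x + w)) (right_mem_segment ℝ x (x + w))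
  simpa using h

lemma one_le_jb (r : ℝ) : 1 ≤ jb r :=
  Real.one_le_sqrt.mpr (by nlinarith [sq_nonneg r])

/-- Peetre's inequality for displacements of length at most one. -/
lemma jb_norm_le_two_mul {E : Type*} [NormedAddCommGroup E] (x w : E) (hw : ‖w‖ ≤ 1) :
    jb ‖x‖ ≤ 2 * jb ‖x + w‖ := by
  have hx : ‖x‖ ≤ ‖x + w‖ + 1 := by
    calc ‖x‖ = ‖(x + w) - w‖ := by simp
      _ ≤ ‖x + w‖ + ‖w‖ := norm_sub_le _ _
      _ ≤ ‖x + w‖ + 1 := by gcongr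
  unfold jb
  refine Real.sqrt_le_iff.mpr ⟨by positivity, ?_⟩
  rw [mul_pow, Real.sq_sqrt (by positivity)]
  nlinarith [norm_nonneg x, sq_nonneg (‖x + w‖ - 1)]

/-- Weighted gradient bound for a function of one Euclidean variable. -/
lemma jb_rpow_mul_norm_gradient_le {E : Type*} [NormedAddCommGroup E] [InnerProductSpace ℝ E]
    [CompleteSpace E] {g : E → ℝ} (hg : ContDiff ℝ 2 g) {ℓ A B : ℝ} (hℓ : 0 ≤ ℓ)
    (hA : ∀ y, jb ‖y‖ ^ (2 * ℓ) * |g y| ≤ A) (hB : ∀ y, ‖iteratedFDeriv ℝ 2 g y‖ ≤ B) (x : E) :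
    jb ‖x‖ ^ ℓ * ‖gradient g x‖ ≤ (2 ^ (2 * ℓ) + 1) * A + B := by
  have hJ0 : 0 < jb ‖x‖ := one_pos.trans_le (one_le_jb _)
  set P := jb ‖x‖ ^ ℓ
  have hP : 1 ≤ P := Real.one_le_rpow (one_le_jb _) hℓ
  have hP0 : 0 < P := one_pos.trans_le hP
  have hPsq : jb ‖x‖ ^ (2 * ℓ) = P ^ 2 := by
    rw [mul_comm, Real.rpow_mul hJ0.le, Real.rpow_two]
  have hB0 : 0 ≤ B := (norm_nonneg _).trans (hB x)
  set G := gradient g x with hG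
  set w : E := (P⁻¹ * ‖G‖⁻¹) • G with hw
  have hwn : ‖w‖ ≤ P⁻¹ := by
    rw [hw, norm_smul, Real.norm_of_nonneg (by positivity), mul_assoc]
    exact mul_le_of_le_one_right (by positivity) inv_mul_le_one
  have hwG : fderiv ℝ g x w = P⁻¹ * ‖G‖ := by
    rw [← inner_gradient_left, ← hG, hw, real_inner_smul_right, real_inner_self_eq_norm_sq]
    rcases eq_or_ne ‖G‖ 0 with h | h
    · simp [h]
    · field_simp
  have htaylor := norm_sub_sub_fderiv_le_of_norm_iteratedFDeriv_two_le hg hB x w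
  rw [hwG, Real.norm_eq_abs] at htaylor
  have hrem : B * ‖w‖ * ‖w‖ ≤ B * P⁻¹ * P⁻¹ := by gcongr
  have hpeetre : P ^ 2 ≤ 2 ^ (2 * ℓ) * jb ‖x + w‖ ^ (2 * ℓ) := by
    rw [← hPsq, ← Real.mul_rpow (by norm_num) (zero_le_one.trans (one_le_jb _))]
    exact Real.rpow_le_rpow hJ0.le
      (jb_norm_le_two_mul x w (hwn.trans (inv_le_one_of_one_le₀ hP))) (by positivity)
  have hshift : P ^ 2 * |g (x + w)| ≤ 2 ^ (2 * ℓ) * A := by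
    calc P ^ 2 * |g (x + w)| ≤ 2 ^ (2 * ℓ) * jb ‖x + w‖ ^ (2 * ℓ) * |g (x + w)| := by gcongr
      _ = 2 ^ (2 * ℓ) * (jb ‖x + w‖ ^ (2 * ℓ) * |g (x + w)|) := by ring
      _ ≤ 2 ^ (2 * ℓ) * A := by gcongr; exact hA _
  have hbase : P ^ 2 * |g x| ≤ A := hPsq ▸ hA x
  have hmain : P⁻¹ * ‖G‖ ≤ |g (x + w)| + |g x| + B * P⁻¹ * P⁻¹ := by
    linarith [(abs_le.mp (htaylor.trans hrem)).1, le_abs_self (g (x + w)), neg_abs_le (g x)]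
  calc P * ‖G‖ = P ^ 2 * (P⁻¹ * ‖G‖) := by field_simp
    _ ≤ P ^ 2 * (|g (x + w)| + |g x| + B * P⁻¹ * P⁻¹) := by gcongr
    _ = P ^ 2 * |g (x + w)| + P ^ 2 * |g x| + B := by field_simp
    _ ≤ (2 ^ (2 * ℓ) + 1) * A + B := by linarith

/-- **Weighted interpolation inequality** in the spatial variable. -/
theorem weighted_interpolation_x
    (d : ℕ) (hd : 2 ≤ d) (ℓ : ℝ) (hℓ : 0 ≤ ℓ) :
    ∃ C : ℝ, 0 < C ∧
      ∀ f : Ed d × Ed d → ℝ, (∀ v : Ed d, ContDiff ℝ 2 fun x => f (x, v)) →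
        ∀ x v : Ed d,
          ENNReal.ofReal ((jb ‖x‖) ^ ℓ * ‖gradient (fun x' => f (x', v)) x‖)
            ≤ ENNReal.ofReal C *
                ((⨆ a : Ed d × Ed d, ENNReal.ofReal ((jb ‖a.1‖) ^ (2 * ℓ) * |f a|))
                  + ⨆ a : Ed d × Ed d,
                      ENNReal.ofReal ‖iteratedFDeriv ℝ 2 (fun x' => f (x', a.2)) a.1‖) := by
  have hC : (0 : ℝ) < 2 ^ (2 * ℓ) + 1 := by positivity
  refine ⟨2 ^ (2 * ℓ) + 1, hC, fun f hf x v => ?_⟩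
  set SA := ⨆ a : Ed d × Ed d, ENNReal.ofReal ((jb ‖a.1‖) ^ (2 * ℓ) * |f a|)
  set SB := ⨆ a : Ed d × Ed d,
    ENNReal.ofReal ‖iteratedFDeriv ℝ 2 (fun x' => f (x', a.2)) a.1‖
  rcases eq_or_ne (SA + SB) ⊤ with htop | htop
  · rw [htop, ENNReal.mul_top (ENNReal.ofReal_pos.mpr hC).ne']
    exact le_top
  obtain ⟨hAtop, hBtop⟩ := ENNReal.add_ne_top.mp htop
  have hA : ∀ y, jb ‖y‖ ^ (2 * ℓ) * |f (y, v)| ≤ SA.toReal := fun y =>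
    (ENNReal.ofReal_le_iff_le_toReal hAtop).mp <|
      le_iSup (fun a : Ed d × Ed d => ENNReal.ofReal ((jb ‖a.1‖) ^ (2 * ℓ) * |f a|)) (y, v)
  have hB : ∀ y, ‖iteratedFDeriv ℝ 2 (fun x' => f (x', v)) y‖ ≤ SB.toReal := fun y =>
    (ENNReal.ofReal_le_iff_le_toReal hBtop).mp <|
      le_iSup (fun a : Ed d × Ed d =>
        ENNReal.ofReal ‖iteratedFDeriv ℝ 2 (fun x' => f (x', a.2)) a.1‖) (y, v)
  rw [← ENNReal.ofReal_toReal htop, ← ENNReal.ofReal_mul hC.le,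
    ENNReal.toReal_add hAtop hBtop]
  refine ENNReal.ofReal_le_ofReal ((jb_rpow_mul_norm_gradient_le (hf v) hℓ hA hB x).trans ?_)
  have hBle : SB.toReal ≤ (2 ^ (2 * ℓ) + 1) * SB.toReal :=
    le_mul_of_one_le_left ENNReal.toReal_nonneg (le_add_of_nonneg_left (by positivity))
  linarith
end
end

section
/- Let d ≥ 2, λ ∈ {−1,1}, and define the hyperbolic lens transform 𝒯(t,x,v) = (tanh t, x/cosh t, v cosh t − x sinh t). For each fixed t, the map (x,v) ↦ (x/cosh t, v cosh t − x sinh t) is symplectic and volume-preserving (its Jacobian matrix is block triangular with blocks (cosh t)^{−1}I_d, 0, −(sinh t)I_d, (cosh t)I_d, and has determinant 1). Moreover, if μ = γ ∘ 𝒯 with μ, γ of class C¹, then μ solves the Vlasov–Poisson system with a repulsive harmonic potential, ∂_t μ + v·∇_x μ + x·∇_v μ + λ E[μ]·∇_v μ = 0 on ℝ×ℝ^d×ℝ^d, if and only if γ solves ∂_s γ + p·∇_q γ + (1−s²)^{(d−4)/2} λ E[γ]·∇_p γ = 0 on (−1,1)×ℝ^d×ℝ^d; in particular the electric fields are related by E[μ](t,x)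 = (cosh t)^{1−d} E[γ](tanh t, x/cosh t). -/
open MeasureTheory Real Set Filter Function
open scoped ENNReal RealInnerProductSpace Topology

noncomputable section

/-- The time slice of the hyperbolic lens transform, as a linear homeomorphism of phase space. -/
def lensEquiv (d : ℕ) (t : ℝ) : (Ed d × Ed d) ≃L[ℝ] (Ed d × Ed d) :=
  ContinuousLinearEquiv.equivOfInverse
    (((Real.cosh t)⁻¹ • ContinuousLinearMap.fst ℝ (Ed d) (Ed d)).prod
      (Real.cosh t • ContinuousLinearMap.snd ℝ (Ed d) (Ed d)
        - Real.sinh t • ContinuousLinearMap.fst ℝ (Ed d) (Ed d)))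
    ((Real.cosh t • ContinuousLinearMap.fst ℝ (Ed d) (Ed d)).prod
      ((Real.cosh t)⁻¹ • ContinuousLinearMap.snd ℝ (Ed d) (Ed d)
        + Real.sinh t • ContinuousLinearMap.fst ℝ (Ed d) (Ed d)))
    (fun a => by
      have h := (Real.cosh_pos t).ne'
      ext i
      · simp [h]
      · simp
        field_simp
        ring)
    (fun a => by
      have h := (Real.cosh_pos t).ne'
      ext i
      · simp [h]
      · simp
        field_simp
        ring)

theorem lensEquiv_apply {d : ℕ} (t : ℝ) (a : Ed d × Ed d) :
    lensEquiv d t a = ((Real.cosh t)⁻¹ • a.1, Real.cosh t • a.2 - Real.sinh t • a.1) := rfl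

theorem measurePreserving_inv_smul_prod_smul {d : ℕ} {r : ℝ} (hr : r ≠ 0) :
    MeasurePreserving (Prod.map (fun x : Ed d => r⁻¹ • x) (fun v : Ed d => r • v))
      volume volume := by
  refine ⟨by fun_prop, ?_⟩
  rw [Measure.volume_eq_prod, ← Measure.map_prod_map _ _ (by fun_prop) (by fun_prop),
    Measure.map_addHaar_smul _ (inv_ne_zero hr), Measure.map_addHaar_smul _ hr,
    Measure.prod_smul_left, Measure.prod_smul_right, smul_smul,
    ← ENNReal.ofReal_mul (abs_nonneg _), ← abs_mul]
  simp [hr]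

theorem measurePreserving_shear {d : ℕ} (a : ℝ) :
    MeasurePreserving (fun xv : Ed d × Ed d => (xv.1, xv.2 - a • xv.1)) volume volume := by
  rw [Measure.volume_eq_prod]
  refine (MeasurePreserving.id volume).skew_product (g := fun x v => v - a • x)
    (by fun_prop) (Eventually.of_forall fun x => ?_)
  exact (measurePreserving_sub_right volume (a • x)).map_eq

theorem measurePreserving_lensEquiv {d : ℕ} (t : ℝ) :
    MeasurePreserving (lensEquiv d t) volume volume := by
  have h := (Real.cosh_pos t).ne'
  convert (measurePreserving_shear (Real.sinh t * Real.cosh t)).comp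
    (measurePreserving_inv_smul_prod_smul (d := d) h) using 1
  ext a i <;> simp [lensEquiv_apply, smul_smul, h]

theorem lensEquiv_symplectic {d : ℕ} (t : ℝ) (a b : Ed d × Ed d) :
    ⟪(lensEquiv d t a).1, (lensEquiv d t b).2⟫ - ⟪(lensEquiv d t a).2, (lensEquiv d t b).1⟫
      = ⟪a.1, b.2⟫ - ⟪a.2, b.1⟫ := by
  have h := (Real.cosh_pos t).ne'
  simp only [lensEquiv_apply, inner_sub_left, inner_sub_right, real_inner_smul_left,
    real_inner_smul_right]
  field_simp
  ring

theorem fieldD_comp_lensEquiv {d : ℕ} (hd : 1 ≤ d) (c t : ℝ) (g : Ed d × Ed d → ℝ) (x : Ed d) :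
    fieldD d c (g ∘ lensEquiv d t) x
      = ((Real.cosh t) ^ (d - 1))⁻¹ • fieldD d c g ((Real.cosh t)⁻¹ • x) := by
  have hpos := Real.cosh_pos t
  have h := hpos.ne'
  unfold fieldD
  have hchange := (measurePreserving_lensEquiv (d := d) t).integral_comp
    (lensEquiv d t).toHomeomorph.measurableEmbedding
    fun yv => ((g yv) ^ 2 * c * (‖(Real.cosh t)⁻¹ • x - yv.1‖ ^ d)⁻¹) •
      ((Real.cosh t)⁻¹ • x - yv.1)
  rw [← hchange, ← integral_smul]
  refine integral_congr_ae (Eventually.of_forall fun a => ?_)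
  simp only [comp_apply, lensEquiv_apply, ← smul_sub, norm_smul, norm_inv, Real.norm_eq_abs,
    abs_of_pos hpos, smul_smul]
  congr 1
  obtain ⟨k, rfl⟩ := Nat.exists_eq_add_of_le' hd
  simp only [Nat.add_sub_cancel, mul_pow, mul_inv, inv_pow, inv_inv]
  field_simp
  ring

theorem one_sub_tanh_sq (t : ℝ) : 1 - Real.tanh t ^ 2 = (Real.cosh t ^ 2)⁻¹ := by
  have h := (Real.cosh_pos t).ne'
  rw [Real.tanh_eq_sinh_div_cosh]
  field_simp
  linarith [Real.cosh_sq t]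

theorem one_sub_tanh_sq_rpow (d : ℕ) (t : ℝ) :
    (1 - Real.tanh t ^ 2) ^ (((d : ℝ) - 4) / 2) = Real.cosh t ^ 4 * (Real.cosh t ^ d)⁻¹ := by
  have h := Real.cosh_pos t
  rw [one_sub_tanh_sq, ← Real.rpow_natCast (Real.cosh t) 2, ← Real.rpow_neg h.le,
    ← Real.rpow_mul h.le]
  rw [← Real.rpow_natCast (Real.cosh t) 4, ← Real.rpow_natCast (Real.cosh t) d,
    ← Real.rpow_neg h.le, ← Real.rpow_add h]
  congr 1
  push_cast
  ring

theorem hasDerivAt_tanh_inv_cosh_sq (t : ℝ) :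
    HasDerivAt Real.tanh ((Real.cosh t ^ 2)⁻¹) t := by
  have h := (Real.cosh_pos t).ne'
  have h1 := (Real.hasDerivAt_sinh t).div (Real.hasDerivAt_cosh t) h
  have h2 : Real.tanh = fun y => Real.sinh y / Real.cosh y := funext Real.tanh_eq_sinh_div_cosh
  have h3 : (Real.cosh t ^ 2)⁻¹
      = (Real.cosh t * Real.cosh t - Real.sinh t * Real.sinh t) / Real.cosh t ^ 2 := by
    rw [← sq, ← sq, Real.cosh_sq_sub_sinh_sq, one_div]
  rw [h2, h3]
  exact h1

theorem hasDerivAt_lens {d : ℕ} (t : ℝ) (x v : Ed d) :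
    HasDerivAt (fun t' => (Real.tanh t', lensEquiv d t' (x, v)))
      ((Real.cosh t ^ 2)⁻¹, (-(Real.sinh t / Real.cosh t ^ 2)) • x,
        Real.sinh t • v - Real.cosh t • x) t := by
  have h := (Real.cosh_pos t).ne'
  refine (hasDerivAt_tanh_inv_cosh_sq t).prodMk (HasDerivAt.prodMk ?_ ?_)
  · have h1 := ((Real.hasDerivAt_cosh t).inv h).smul_const x
    rwa [neg_div] at h1
  · exact ((Real.hasDerivAt_cosh t).smul_const v).sub ((Real.hasDerivAt_sinh t).smul_const x)

section Slices

variable {E F : Type*} [NormedAddCommGroup E] [NormedSpace ℝ E] [NormedAddCommGroup F]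
  [NormedSpace ℝ F] {γ : ℝ → E × F → ℝ} {D : ℝ × (E × F) →L[ℝ] ℝ} {s : ℝ} {q : E} {p : F}

theorem hasDerivAt_slice_time
    (hD : HasFDerivAt (fun a : ℝ × (E × F) => γ a.1 a.2) D (s, q, p)) :
    HasDerivAt (fun s' => γ s' (q, p)) (D (1, 0, 0)) s :=
  HasFDerivAt.comp_hasDerivAt (f := fun s' => (s', q, p)) s hD ((hasDerivAt_id s).prodMk (hasDerivAt_const s (q, p)))

theorem hasFDerivAt_slice
    (hD : HasFDerivAt (fun a : ℝ × (E × F) => γ a.1 a.2) D (s, q, p)) :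
    HasFDerivAt (γ s) (D.comp (ContinuousLinearMap.inr ℝ ℝ (E × F))) (q, p) :=
  hD.comp (q, p) (hasFDerivAt_prodMk_right s (q, p))

theorem fderiv_slice_fst {g : E × F → ℝ} {L : E × F →L[ℝ] ℝ} (hg : HasFDerivAt g L (q, p))
    (w : E) : fderiv ℝ (fun q' => g (q', p)) q w = L (w, 0) := by
  have h : HasFDerivAt (fun q' => g (q', p)) (L.comp (ContinuousLinearMap.inl ℝ E F)) q :=
    hg.comp q (hasFDerivAt_prodMk_left q p)
  rw [h.fderiv]
  simp

theorem fderiv_slice_snd {g : E × F → ℝ} {L : E × F →L[ℝ] ℝ} (hg : HasFDerivAt g L (q, p))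
    (w : F) : fderiv ℝ (fun p' => g (q, p')) p w = L (0, w) := by
  have h : HasFDerivAt (fun p' => g (q, p')) (L.comp (ContinuousLinearMap.inr ℝ E F)) p :=
    hg.comp p (hasFDerivAt_prodMk_right q p)
  rw [h.fderiv]
  simp

end Slices

/-- The two transport operators are intertwined by the lens transform when the force fields
`e` and `e'` satisfy `e' = (cosh t)³ e`. -/
theorem transport_lens {d : ℕ} {μ γ : ℝ → Ed d × Ed d → ℝ}
    (hμγ : ∀ t, μ t = γ (Real.tanh t) ∘ lensEquiv d t) (t : ℝ) (x v q p e e' : Ed d)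
    (hqp : lensEquiv d t (x, v) = (q, p))
    (hγ : DifferentiableAt ℝ (fun a : ℝ × (Ed d × Ed d) => γ a.1 a.2) (Real.tanh t, q, p))
    (he : e' = Real.cosh t ^ 3 • e) :
    deriv (fun t' => μ t' (x, v)) t
        + fderiv ℝ (fun x' => μ t (x', v)) x v
        + fderiv ℝ (fun v' => μ t (x, v')) v x
        + fderiv ℝ (fun v' => μ t (x, v')) v e
      = (Real.cosh t ^ 2)⁻¹ *
        (deriv (fun s' => γ s' (q, p)) (Real.tanh t)
          + fderiv ℝ (fun q' => γ (Real.tanh t) (q', p)) q p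
          + fderiv ℝ (fun p' => γ (Real.tanh t) (q, p')) p e') := by
  have hpos := Real.cosh_pos t
  have h := hpos.ne'
  obtain ⟨D, hD⟩ := hγ
  have hslice := hasFDerivAt_slice hD
  have hμ : HasFDerivAt (μ t) ((D.comp (ContinuousLinearMap.inr ℝ ℝ (Ed d × Ed d))).comp
      (lensEquiv d t : Ed d × Ed d →L[ℝ] Ed d × Ed d)) (x, v) := by
    rw [hμγ]
    rw [← hqp] at hslice
    exact hslice.comp (x, v) (lensEquiv d t).hasFDerivAt
  have ht : HasDerivAt (fun t' => μ t' (x, v)) (D ((Real.cosh t ^ 2)⁻¹,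
      (-(Real.sinh t / Real.cosh t ^ 2)) • x, Real.sinh t • v - Real.cosh t • x)) t := by
    simp only [hμγ]
    rw [← hqp] at hD
    exact hD.comp_hasDerivAt t (hasDerivAt_lens t x v)
  rw [fderiv_slice_fst hμ, fderiv_slice_snd hμ, fderiv_slice_snd hμ, fderiv_slice_fst hslice,
    fderiv_slice_snd hslice, ht.deriv, (hasDerivAt_slice_time hD).deriv]
  simp only [ContinuousLinearMap.comp_apply, ContinuousLinearEquiv.coe_coe,
    ContinuousLinearMap.inr_apply, ← map_add, ← smul_eq_mul, ← map_smul]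
  rw [lensEquiv_apply, Prod.mk.injEq] at hqp
  congr 1
  ext i
  · simp
  · simp [lensEquiv_apply, ← hqp.2]
    field_simp
    ring
  · simp [lensEquiv_apply, he]
    field_simp
    ring

/-- **The hyperbolic lens transform**: it is symplectic and volume-preserving, it intertwines
the Vlasov--Poisson system with a repulsive harmonic potential with the lens-transformed
system, and it transforms the electric field by `E[μ](t,x) = (cosh t)^{1-d} E[γ](tanh t, x/cosh t)`. -/
theorem hyperbolic_lens_transform
    (d : ℕ) (hd : 2 ≤ d) (c : ℝ) (hc : 0 < c) (lam : ℝ) (hlam : lam = 1 ∨ lam = -1) :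
    (∀ t : ℝ,
      MeasurePreserving
        (fun xv : Ed d × Ed d =>
          ((Real.cosh t)⁻¹ • xv.1, Real.cosh t • xv.2 - Real.sinh t • xv.1))
        volume volume) ∧
    (∀ t : ℝ, ∀ a b : Ed d × Ed d,
      ⟪((Real.cosh t)⁻¹ • a.1 : Ed d),
          (Real.cosh t • b.2 - Real.sinh t • b.1 : Ed d)⟫
        - ⟪(Real.cosh t • a.2 - Real.sinh t • a.1 : Ed d),
            ((Real.cosh t)⁻¹ • b.1 : Ed d)⟫
        = ⟪a.1, b.2⟫ - ⟪a.2, b.1⟫) ∧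
    ∀ μ γ : ℝ → Ed d × Ed d → ℝ,
      ContDiff ℝ 1 (fun a : ℝ × (Ed d × Ed d) => μ a.1 a.2) →
      ContDiffOn ℝ 1 (fun a : ℝ × (Ed d × Ed d) => γ a.1 a.2) (Ioo (-1 : ℝ) 1 ×ˢ univ) →
      (∀ (t : ℝ) (x v : Ed d),
        μ t (x, v)
          = γ (Real.tanh t) ((Real.cosh t)⁻¹ • x, Real.cosh t • v - Real.sinh t • x)) →
      ((∀ (t : ℝ) (x : Ed d),
          fieldD d c (μ t) x
            = ((Real.cosh t) ^ (d - 1))⁻¹ •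
                fieldD d c (γ (Real.tanh t)) ((Real.cosh t)⁻¹ • x)) ∧
        ((∀ (t : ℝ) (x v : Ed d),
            deriv (fun t' => μ t' (x, v)) t
              + fderiv ℝ (fun x' => μ t (x', v)) x v
              + fderiv ℝ (fun v' => μ t (x, v')) v x
              + fderiv ℝ (fun v' => μ t (x, v')) v (lam • fieldD d c (μ t) x) = 0)
          ↔ (∀ s ∈ Ioo (-1 : ℝ) 1, ∀ q p : Ed d,
              deriv (fun s' => γ s' (q, p)) s
                + fderiv ℝ (fun q' => γ s (q', p)) q p
                + fderiv ℝ (fun p' => γ s (q, p')) p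
                    ((lam * (1 - s ^ 2) ^ (((d : ℝ) - 4) / 2)) •
                      fieldD d c (γ s) q) = 0))) := by
  refine ⟨measurePreserving_lensEquiv, lensEquiv_symplectic, fun μ γ _ hγ hμγ => ?_⟩
  have hcomp : ∀ t, μ t = γ (Real.tanh t) ∘ lensEquiv d t :=
    fun t => funext fun a => hμγ t a.1 a.2
  have hfield : ∀ (t : ℝ) (x : Ed d), fieldD d c (μ t) x
      = ((Real.cosh t) ^ (d - 1))⁻¹ •
          fieldD d c (γ (Real.tanh t)) ((Real.cosh t)⁻¹ • x) := fun t x => by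
    rw [hcomp, fieldD_comp_lensEquiv (by lia)]
  have hdiff : ∀ s ∈ Ioo (-1 : ℝ) 1, ∀ a : Ed d × Ed d,
      DifferentiableAt ℝ (fun a : ℝ × (Ed d × Ed d) => γ a.1 a.2) (s, a) := fun s hs a =>
    (hγ.contDiffAt ((isOpen_Ioo.prod isOpen_univ).mem_nhds ⟨hs, mem_univ a⟩)).differentiableAt
      one_ne_zero
  have htanh : ∀ t : ℝ, Real.tanh t ∈ Ioo (-1 : ℝ) 1 :=
    fun t => ⟨Real.neg_one_lt_tanh t, Real.tanh_lt_one t⟩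
  have hforce : ∀ (t : ℝ) (x : Ed d),
      (lam * (1 - Real.tanh t ^ 2) ^ (((d : ℝ) - 4) / 2)) •
          fieldD d c (γ (Real.tanh t)) ((Real.cosh t)⁻¹ • x)
        = Real.cosh t ^ 3 • lam • fieldD d c (μ t) x := fun t x => by
    have h := (Real.cosh_pos t).ne'
    rw [hfield, one_sub_tanh_sq_rpow, smul_smul, smul_smul]
    congr 1
    obtain ⟨k, rfl⟩ := Nat.exists_eq_add_of_le' (one_le_two.trans hd)
    simp only [Nat.add_sub_cancel]
    field_simp
    ring
  have key := fun (t : ℝ) (x v : Ed d) =>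
    transport_lens hcomp t x v _ _ (lam • fieldD d c (μ t) x) _ (lensEquiv_apply t (x, v))
      (hdiff _ (htanh t) _) (hforce t x)
  refine ⟨hfield, fun H s hs q p => ?_, fun H t x v => ?_⟩
  · obtain ⟨t, rfl⟩ : ∃ t, Real.tanh t = s := ⟨Real.artanh s, Real.tanh_artanh hs⟩
    obtain ⟨⟨x, v⟩, hxv⟩ := (lensEquiv d t).surjective (q, p)
    obtain ⟨rfl, rfl⟩ := Prod.mk.inj hxv
    have := H t x v
    rw [key] at this
    exact (mul_eq_zero.mp this).resolve_left
      (inv_ne_zero (pow_ne_zero 2 (Real.cosh_pos t).ne'))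
  · rw [key, H _ (htanh t), mul_zero]
end
end
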